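/- arXiv:1412.0444 — 9 statements merged into one kernel-verified Lean document; each statement's English description precedes it below -/
import Mathlib

section
/- For any connected simple graph G on {1,…,n}, toppling dominance is a partial order on ℤ^n: it is reflexive, transitive, and antisymmetric (if β ≤ α and α ≤ β then α = β). -/
open Finset

/-- The toppling vector `Δ_i` of vertex `i` in the graph `G`:
it has `-(deg i)` at position `i`, `1` at each neighbor of `i`, and `0` elsewhere. -/
def topDelta {n : ℕ} (G : SimpleGraph (Fin n)) [DecidableRel G.Adj] (i : Fin n) :
    Fin n → ℤ :=
  fun j => if j = i then -(G.degree i : ℤ) else if G.Adj i j then 1 else 0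

/-- The map `T^a : ℤ^n → ℤ^n`, `α ↦ α + Σ_i a_i • Δ_i`. -/
def topT {n : ℕ} (G : SimpleGraph (Fin n)) [DecidableRel G.Adj] (a : Fin n → ℤ)
    (α : Fin n → ℤ) : Fin n → ℤ :=
  α + ∑ i, a i • topDelta G i

/-- Toppling dominance: `β ≤ α` iff `β = T^λ(α)` for some weakly decreasing `λ ∈ ℕ^n`. -/
def topDom {n : ℕ} (G : SimpleGraph (Fin n)) [DecidableRel G.Adj]
    (β α : Fin n → ℤ) : Prop :=
  ∃ l : Fin n → ℕ, Antitone l ∧ β = topT G (fun i => (l i : ℤ)) α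

theorem sum_smul_topDelta_apply {n : ℕ} (G : SimpleGraph (Fin n)) [DecidableRel G.Adj]
    (a : Fin n → ℤ) (j : Fin n) :
    (∑ i, a i • topDelta G i) j = ∑ u ∈ G.neighborFinset j, a u - G.degree j * a j := by
  have h : ∀ i, a i * topDelta G i j =
      (if G.Adj j i then a i else 0) - if j = i then (G.degree j : ℤ) * a j else 0 := by
    intro i
    unfold topDelta
    rcases eq_or_ne j i with rfl | hji
    · simp [mul_comm]
    · simp [hji, G.adj_comm i j]
  simp only [Finset.sum_apply, Pi.smul_apply, smul_eq_mul, h, Finset.sum_sub_distrib,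
    Finset.sum_ite_eq, Finset.mem_univ, if_true]
  rw [← Finset.sum_filter, SimpleGraph.neighborFinset_eq_filter]

/-- Toppling every vertex equally often has no effect. -/
theorem sum_smul_topDelta_eq_zero_of_forall_eq {n : ℕ} (G : SimpleGraph (Fin n))
    [DecidableRel G.Adj] {a : Fin n → ℤ} (ha : ∀ i j, a i = a j) :
    ∑ i, a i • topDelta G i = 0 := by
  funext j
  rw [sum_smul_topDelta_apply, Finset.sum_congr rfl fun u _ => ha u j]
  simp

/-- On a connected graph, only constant vectors topple trivially. -/
theorem eq_of_sum_smul_topDelta_eq_zero {n : ℕ} {G : SimpleGraph (Fin n)}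
    [DecidableRel G.Adj] (hG : G.Connected) {a : Fin n → ℤ}
    (ha : ∑ i, a i • topDelta G i = 0) (i j : Fin n) : a i = a j := by
  have h : (G.lapMatrix ℝ).mulVec (fun i => (a i : ℝ)) = 0 := by
    funext k
    have hk : (∑ i, a i • topDelta G i) k = 0 := congrFun ha k
    rw [sum_smul_topDelta_apply] at hk
    rw [SimpleGraph.lapMatrix_mulVec_apply, Pi.zero_apply]
    have hk' : ((∑ u ∈ G.neighborFinset k, a u - G.degree k * a k : ℤ) : ℝ) = 0 := by
      rw [hk, Int.cast_zero]
    push_cast at hk'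
    linarith
  exact_mod_cast G.lapMatrix_mulVec_eq_zero_iff_forall_reachable.mp h i j (hG.preconnected i j)

theorem topT_add {n : ℕ} (G : SimpleGraph (Fin n)) [DecidableRel G.Adj] (a b α : Fin n → ℤ) :
    topT G (a + b) α = topT G a (topT G b α) := by
  simp only [topT, Pi.add_apply, add_smul, Finset.sum_add_distrib]
  abel

/-- Toppling dominance is a partial order on `ℤ^n`: reflexive, transitive and
antisymmetric. (Here `topDom G β α` means `β ≤ α`.) -/
theorem topDom_partialOrder {n : ℕ} (hn : 0 < n) (G : SimpleGraph (Fin n))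
    [DecidableRel G.Adj] (hG : G.Connected) :
    Reflexive (topDom G) ∧ Transitive (topDom G) ∧
      (∀ α β : Fin n → ℤ, topDom G β α → topDom G α β → α = β) := by
  refine ⟨fun α => ⟨0, antitone_const, by simp [topT]⟩, ?_, ?_⟩
  · rintro _ _ α ⟨l, hl, rfl⟩ ⟨m, hm, rfl⟩
    refine ⟨l + m, hl.add hm, ?_⟩
    rw [← topT_add]
    congr 1
  · rintro α _ ⟨l, hl, rfl⟩ ⟨m, hm, h⟩
    rw [← topT_add] at h
    have hconst := eq_of_sum_smul_topDelta_eq_zero hG (left_eq_add.mp h)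
    have hl_const : ∀ i j, (l i : ℤ) = l j := by
      intro i j
      have hij := hconst i j
      simp only [Pi.add_apply] at hij
      rcases le_total i j with hle | hle <;>
      · have h₁ := hl hle
        have h₂ := hm hle
        omega
    rw [topT, sum_smul_topDelta_eq_zero_of_forall_eq G hl_const, add_zero]
end

section
/- Let G be a connected simple graph on {1,…,n} and let α, β ∈ ℤ^n with β ≤ α in toppling dominance. Then there exists a unique λ ∈ P_n such that T^λ(α) = β. -/
open Finset

open scoped Matrix in
theorem cast_sum_smul_topDelta_apply {n : ℕ} (G : SimpleGraph (Fin n)) [DecidableRel G.Adj]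
    (a : Fin n → ℤ) (j : Fin n) :
    (((∑ i, a i • topDelta G i) j : ℤ) : ℝ) =
      -(G.lapMatrix ℝ *ᵥ fun i => (a i : ℝ)) j := by
  have entry (i : Fin n) : ((topDelta G i j : ℤ) : ℝ) = -G.lapMatrix ℝ j i := by
    by_cases hij : j = i
    · subst hij
      simp [topDelta, SimpleGraph.lapMatrix, SimpleGraph.degMatrix]
    · simp [topDelta, SimpleGraph.lapMatrix, SimpleGraph.degMatrix, hij, G.adj_comm i j]
  simp [Matrix.mulVec, dotProduct, Finset.sum_apply, entry, mul_comm]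

open scoped Matrix in
/-- For a connected graph, the integer relations between the toppling vectors are exactly the
constant vectors. -/
theorem sum_smul_topDelta_eq_zero_iff {n : ℕ} {G : SimpleGraph (Fin n)} [DecidableRel G.Adj]
    (hG : G.Connected) {a : Fin n → ℤ} :
    ∑ i, a i • topDelta G i = 0 ↔ ∀ i j, a i = a j := by
  have key : ∑ i, a i • topDelta G i = 0 ↔
      G.lapMatrix ℝ *ᵥ (fun i => (a i : ℝ)) = 0 := by
    simp only [funext_iff, Pi.zero_apply]
    refine forall_congr' fun j => ?_
    rw [← @Int.cast_eq_zero ℝ, cast_sum_smul_topDelta_apply, neg_eq_zero]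
  rw [key, G.lapMatrix_mulVec_eq_zero_iff_forall_reachable]
  simp [hG.preconnected _ _]

theorem topT_eq_topT_iff {n : ℕ} {G : SimpleGraph (Fin n)} [DecidableRel G.Adj]
    (hG : G.Connected) {a b α : Fin n → ℤ} :
    topT G a α = topT G b α ↔ ∀ i j, a i - b i = a j - b j := by
  rw [← sum_smul_topDelta_eq_zero_iff hG (a := fun i => a i - b i)]
  simp [topT, sub_smul, sub_eq_zero]

/-- If `β ≤ α` in toppling dominance, there is a unique `λ ∈ P_n` (a weakly
decreasing vector of naturals with last entry `0`) such that `T^λ(α) = β`. -/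
theorem exists_unique_Pn {n : ℕ} (hn : 0 < n) (G : SimpleGraph (Fin n))
    [DecidableRel G.Adj] (hG : G.Connected) (α β : Fin n → ℤ)
    (h : topDom G β α) :
    ∃! l : Fin n → ℕ, Antitone l ∧ l ⟨n - 1, by omega⟩ = 0 ∧
      topT G (fun i => (l i : ℤ)) α = β := by
  obtain ⟨m, hm, rfl⟩ := h
  have last_le (i : Fin n) : m ⟨n - 1, by omega⟩ ≤ m i :=
    hm (Fin.le_def.2 (Nat.le_sub_one_of_lt i.2))
  refine ⟨fun i => m i - m ⟨n - 1, by omega⟩, ⟨fun i j hij => ?_, Nat.sub_self _, ?_⟩, ?_⟩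
  · exact Nat.sub_le_sub_right (hm hij) _
  · rw [topT_eq_topT_iff hG]
    intro i j
    rw [Nat.cast_sub (last_le i), Nat.cast_sub (last_le j)]
    ring
  · rintro l ⟨-, hl, hT⟩
    funext i
    have hi := (topT_eq_topT_iff hG).1 hT i ⟨n - 1, by omega⟩
    have := last_le i
    omega
end

section
/- Let G be a connected simple graph on {1,…,n}, let α, β ∈ ℤ^n with β ≤ α, and let λ ∈ P_n be the unique element with T^λ(α) = β. Then every Yamanouchi word w over {1,…,n} whose content μ satisfies T^μ(α) = β has length at least |λ| = λ_1 + λ_2 + ⋯ + λ_n, and its length equals |λ| if and only if its content is exactly λ. -/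
open Finset

/-- A word over the alphabet `{1,…,n}` (encoded as `Fin n`, with letter `i+1`
encoded by `i : Fin n`) is Yamanouchi if in every prefix each letter occurs at
least as often as its successor. -/
def IsYamanouchi {n : ℕ} (w : List (Fin n)) : Prop :=
  ∀ k : ℕ, ∀ i j : Fin n, (j : ℕ) + 1 = (i : ℕ) →
    (w.take k).count i ≤ (w.take k).count j

/-- Toppling along `a` subtracts the graph Laplacian applied to `a`. -/
lemma sum_smul_topDelta {n : ℕ} (G : SimpleGraph (Fin n)) [DecidableRel G.Adj] (a : Fin n → ℤ) :
    ∑ i, a i • topDelta G i = -(G.lapMatrix ℤ).mulVec a := by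
  ext j
  have hterm : ∀ i, a i * topDelta G i j = -(G.lapMatrix ℤ j i * a i) := by
    intro i
    by_cases hij : j = i
    · subst hij
      simp [topDelta, SimpleGraph.lapMatrix, SimpleGraph.degMatrix, mul_comm]
    · simp [topDelta, SimpleGraph.lapMatrix, SimpleGraph.degMatrix, hij,
        G.adj_comm i j]
  simp [Matrix.mulVec, dotProduct, Finset.sum_apply, hterm]

/-- On a connected graph, the kernel of the Laplacian over `ℤ` consists of constant vectors. -/
lemma eq_of_lapMatrix_mulVec_eq_zero {n : ℕ} (G : SimpleGraph (Fin n)) [DecidableRel G.Adj]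
    (hG : G.Connected) (d : Fin n → ℤ) (hd : (G.lapMatrix ℤ).mulVec d = 0) (i j : Fin n) :
    d i = d j := by
  have hmap : (G.lapMatrix ℝ) = (G.lapMatrix ℤ).map (Int.castRingHom ℝ) := by
    ext i j
    by_cases hij : i = j <;> by_cases hadj : G.Adj i j <;>
      simp [SimpleGraph.lapMatrix, SimpleGraph.degMatrix, hij, hadj,
        SimpleGraph.adjMatrix_apply]
  have hreal : (G.lapMatrix ℝ).mulVec (fun k => (d k : ℝ)) = 0 := by
    ext k
    have h := RingHom.map_mulVec (Int.castRingHom ℝ) (G.lapMatrix ℤ) d k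
    rw [hd, ← hmap] at h
    simpa [Function.comp_def] using h.symm
  exact_mod_cast (G.lapMatrix_mulVec_eq_zero_iff_forall_reachable.mp hreal) i j
    (hG.preconnected i j)

/-- On a connected graph, toppling vectors with the same effect differ by a constant vector. -/
lemma sub_eq_sub_of_topT_eq {n : ℕ} (G : SimpleGraph (Fin n)) [DecidableRel G.Adj]
    (hG : G.Connected) {α a b : Fin n → ℤ} (h : topT G a α = topT G b α) (i j : Fin n) :
    a i - b i = a j - b j := by
  refine eq_of_lapMatrix_mulVec_eq_zero G hG (a - b) ?_ i j
  rw [topT, topT, sum_smul_topDelta, sum_smul_topDelta, add_right_inj, neg_inj] at h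
  rw [Matrix.mulVec_sub, h, sub_self]

/-- Let `λ ∈ P_n` be the unique element with `T^λ(α) = β`.  Every Yamanouchi
word whose content `μ` satisfies `T^μ(α) = β` has length at least
`|λ| = λ_1 + ⋯ + λ_n`, with equality iff its content is exactly `λ`. -/
theorem yamanouchi_min_length {n : ℕ} (hn : 0 < n) (G : SimpleGraph (Fin n))
    [DecidableRel G.Adj] (hG : G.Connected) (α β : Fin n → ℤ)
    (l : Fin n → ℕ) (hl : Antitone l) (hlast : l ⟨n - 1, by omega⟩ = 0)
    (hlαβ : topT G (fun i => (l i : ℤ)) α = β)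
    (w : List (Fin n)) (hw : IsYamanouchi w)
    (hcontent : topT G (fun i => ((w.count i : ℕ) : ℤ)) α = β) :
    (∑ i, l i) ≤ w.length ∧ (w.length = ∑ i, l i ↔ ∀ i, w.count i = l i) := by
  have hconst := sub_eq_sub_of_topT_eq G hG (hcontent.trans hlαβ.symm)
  set last : Fin n := ⟨n - 1, by omega⟩
  have hcount : ∀ i, w.count i = l i + w.count last := by
    intro i
    have := hconst i last
    omega
  have hlen : w.length = ∑ i, l i + n * w.count last := by
    calc w.length = ∑ i, w.count i := by
          simpa using (Multiset.sum_count_eq_card (s := Finset.univ) (m := (w : Multiset (Fin n)))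
            (by simp)).symm
      _ = ∑ i, (l i + w.count last) := Finset.sum_congr rfl fun i _ => hcount i
      _ = ∑ i, l i + n * w.count last := by simp [Finset.sum_add_distrib]
  refine ⟨by omega, fun h => ?_, fun h => ?_⟩
  · have hzero : w.count last = 0 := by
      have : n * w.count last = 0 := by omega
      exact (mul_eq_zero.mp this).resolve_left hn.ne'
    intro i
    rw [hcount i, hzero, add_zero]
  · rw [hlen, h last, hlast, mul_zero, add_zero]
end

section
/- Let G be a connected simple graph on {1,…,n}, let λ ∈ P_n, and let M be a finite multiset of pairs (i,j) with 1 ≤ i < j ≤ n such that T^λ = ∘_{(i,j)∈M} T_{[i,j]} (as maps ℤ^n → ℤ^n). Then (a) λ_1 + λ_2 + ⋯ + λ_n = Σ_{(i,j)∈M} (C(j,2) − C(i,2)), where C(m,2) = m(m−1)/2; (b) λ_1 = Σ_{(i,j)∈M} (j − i); and (c) setting ℓ₁ = λ_1+⋯+λ_n, ℓ₂ = λ_1, ℓ₃ = |M| (counted with multiplicity) and d = the number of distinct pairs occurring in M, one has ℓ₁ ≥ ℓ₂ ≥ ℓ₃ ≥ d ≥ 0. -/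
open Finset

/-- The translation vector of `T_{[i,j]} = T_{[i]} ∘ T_{[i+1]} ∘ … ∘ T_{[j−1]}`
(1-based), where `T_{[m]} = T_1 ∘ … ∘ T_m` translates by `∑_{k < m} Δ_k`.
Since all topplings are translations, `T_{[i,j]}(α) = α + TbijVec G i j`. -/
def TbijVec {n : ℕ} (G : SimpleGraph (Fin n)) [DecidableRel G.Adj] (i j : ℕ) :
    Fin n → ℤ :=
  ∑ m ∈ Finset.Ico i j, ∑ k ∈ Finset.univ.filter (fun k : Fin n => (k : ℕ) < m),
    topDelta G k

/-- The number of times each vertex is toppled by `T_{[i,j]}`. -/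
def tbijCount (n i j : ℕ) : Fin n → ℤ :=
  fun k => ∑ m ∈ Ico i j, if (k : ℕ) < m then 1 else 0

theorem tbijVec_eq_linearCombination {n : ℕ} (G : SimpleGraph (Fin n)) [DecidableRel G.Adj]
    (i j : ℕ) :
    TbijVec G i j = Fintype.linearCombination ℤ (topDelta G) (tbijCount n i j) := by
  simp only [TbijVec, tbijCount, Fintype.linearCombination_apply, Finset.sum_smul]
  rw [Finset.sum_comm]
  refine Finset.sum_congr rfl fun m _ => ?_
  simp [Finset.sum_filter, ite_smul]

theorem tbijCount_zero {n i j : ℕ} (hn : 0 < n) (hi : 1 ≤ i) (hij : i ≤ j) :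
    tbijCount n i j ⟨0, hn⟩ = (j : ℤ) - i := by
  have h : tbijCount n i j ⟨0, hn⟩ = ∑ m ∈ Ico i j, 1 :=
    Finset.sum_congr rfl fun m hm => if_pos (by simp at hm ⊢; omega)
  rw [h]
  simp [Nat.cast_sub hij]

theorem tbijCount_last {n i j : ℕ} (hn : 0 < n) (hj : j ≤ n) :
    tbijCount n i j ⟨n - 1, by omega⟩ = 0 :=
  Finset.sum_eq_zero fun m hm => if_neg (by simp at hm ⊢; omega)

theorem sum_Ico_cast_eq_choose_sub {i j : ℕ} (hij : i ≤ j) :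
    ∑ m ∈ Ico i j, (m : ℤ) = (Nat.choose j 2 : ℤ) - (Nat.choose i 2 : ℤ) := by
  induction j, hij using Nat.le_induction with
  | base => simp
  | succ k hk ih =>
    rw [Finset.sum_Ico_succ_top hk, ih, Nat.choose_succ_succ' k 1]
    push_cast [Nat.choose_one_right]
    ring

theorem sum_tbijCount {n i j : ℕ} (hij : i ≤ j) (hj : j ≤ n) :
    ∑ k, tbijCount n i j k = (Nat.choose j 2 : ℤ) - (Nat.choose i 2 : ℤ) := by
  rw [← sum_Ico_cast_eq_choose_sub hij]
  simp only [tbijCount]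
  rw [Finset.sum_comm]
  refine Finset.sum_congr rfl fun m hm => ?_
  have hm' : m ≤ n := by simp at hm; omega
  rw [Fin.sum_univ_eq_sum_range (fun k => if k < m then (1 : ℤ) else 0) n,
    ← Finset.sum_filter]
  have : (range n).filter (· < m) = range m := by ext; simp; omega
  simp [this]

theorem linearCombination_topDelta_apply {n : ℕ} (G : SimpleGraph (Fin n)) [DecidableRel G.Adj]
    (c : Fin n → ℤ) (v : Fin n) :
    ((Fintype.linearCombination ℤ (topDelta G) c v : ℤ) : ℝ) =
      -(G.lapMatrix ℝ).mulVec (fun k => (c k : ℝ)) v := by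
  have h (k : Fin n) : (topDelta G k v : ℝ) = -(G.lapMatrix ℝ v k) := by
    rcases eq_or_ne v k with rfl | hvk
    · simp [topDelta, SimpleGraph.lapMatrix, SimpleGraph.degMatrix]
    · simp [topDelta, SimpleGraph.lapMatrix, SimpleGraph.degMatrix, hvk, G.adj_comm k v]
  simp [Fintype.linearCombination_apply, Matrix.mulVec, dotProduct, h, mul_comm]

/-- Topplings of a connected graph satisfy only the relation that toppling every vertex equally
often does nothing. -/
theorem eq_of_linearCombination_topDelta_eq_zero {n : ℕ} {G : SimpleGraph (Fin n)}
    [DecidableRel G.Adj] (hG : G.Connected) {c : Fin n → ℤ}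
    (hc : Fintype.linearCombination ℤ (topDelta G) c = 0) (u v : Fin n) : c u = c v := by
  have h : (G.lapMatrix ℝ).mulVec (fun k => (c k : ℝ)) = 0 := by
    ext w
    simpa [hc] using (linearCombination_topDelta_apply G c w).symm
  exact_mod_cast G.lapMatrix_mulVec_eq_zero_iff_forall_reachable.mp h u v (hG u v)

/-- Statistics of a decomposition `T^λ = ∘_{(i,j)∈M} T_{[i,j]}`: with
`ℓ₁ = |λ|`, `ℓ₂ = λ_1`, `ℓ₃ = |M|` and `d` the number of distinct pairs in `M`,
one has `ℓ₁ = Σ_{(i,j)∈M} (C(j,2) − C(i,2))`, `ℓ₂ = Σ_{(i,j)∈M} (j − i)`, and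
`ℓ₁ ≥ ℓ₂ ≥ ℓ₃ ≥ d ≥ 0`. -/
theorem decomposition_statistics {n : ℕ} (hn : 0 < n) (G : SimpleGraph (Fin n))
    [DecidableRel G.Adj] (hG : G.Connected)
    (l : Fin n → ℕ) (hl : Antitone l) (hlast : l ⟨n - 1, by omega⟩ = 0)
    (M : Multiset (ℕ × ℕ)) (hM : ∀ p ∈ M, 1 ≤ p.1 ∧ p.1 < p.2 ∧ p.2 ≤ n)
    (hdec : ∀ α : Fin n → ℤ,
      topT G (fun i => (l i : ℤ)) α = α + (M.map (fun p => TbijVec G p.1 p.2)).sum) :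
    ((∑ i, (l i : ℤ)) =
        (M.map (fun p => (Nat.choose p.2 2 : ℤ) - (Nat.choose p.1 2 : ℤ))).sum) ∧
      ((l ⟨0, hn⟩ : ℤ) = (M.map (fun p => (p.2 : ℤ) - (p.1 : ℤ))).sum) ∧
      (l ⟨0, hn⟩ ≤ ∑ i, l i) ∧ (Multiset.card M ≤ l ⟨0, hn⟩) ∧
      (M.toFinset.card ≤ Multiset.card M) ∧ (0 ≤ M.toFinset.card) := by
  set w : Fin n → ℤ := fun i => (l i : ℤ)
  have hw : w = (M.map fun p => tbijCount n p.1 p.2).sum := by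
    set b := (M.map fun p => tbijCount n p.1 p.2).sum with hb
    have hlin : Fintype.linearCombination ℤ (topDelta G) (w - b) = 0 := by
      have h := hdec 0
      simp only [topT, zero_add, tbijVec_eq_linearCombination] at h
      rw [map_sub, hb, map_multiset_sum, Multiset.map_map, sub_eq_zero,
        Fintype.linearCombination_apply]
      exact h
    have hblast : b ⟨n - 1, by omega⟩ = 0 := by
      rw [hb, Pi.multiset_sum_apply, Multiset.map_map]
      refine Multiset.sum_eq_zero fun x hx => ?_
      obtain ⟨p, hp, rfl⟩ := Multiset.mem_map.mp hx
      exact tbijCount_last hn (hM p hp).2.2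
    ext k
    have h := eq_of_linearCombination_topDelta_eq_zero hG hlin k ⟨n - 1, by omega⟩
    simpa [w, hlast, hblast, sub_eq_zero] using h
  have hsum : ∑ i, w i =
      (M.map fun p => (Nat.choose p.2 2 : ℤ) - (Nat.choose p.1 2 : ℤ)).sum := by
    have h := map_multiset_sum (∑ i, Pi.evalAddMonoidHom (fun _ : Fin n => ℤ) i)
      (M.map fun p => tbijCount n p.1 p.2)
    rw [← hw, Multiset.map_map] at h
    simp only [AddMonoidHom.finsetSum_apply, Pi.evalAddMonoidHom_apply, Function.comp_def] at h
    rw [h]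
    exact congrArg _ (Multiset.map_congr rfl fun p hp =>
      sum_tbijCount (hM p hp).2.1.le (hM p hp).2.2)
  have hzero : w ⟨0, hn⟩ = (M.map fun p => (p.2 : ℤ) - (p.1 : ℤ)).sum := by
    rw [hw, Pi.multiset_sum_apply, Multiset.map_map]
    exact congrArg _ (Multiset.map_congr rfl fun p hp =>
      tbijCount_zero hn (hM p hp).1 (hM p hp).2.1.le)
  refine ⟨hsum, hzero, Finset.single_le_sum (fun _ _ => Nat.zero_le _) (Finset.mem_univ _), ?_,
    M.toFinset_card_le, Nat.zero_le _⟩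
  have hcard := Multiset.card_nsmul_le_sum
    (s := M.map fun p => (p.2 : ℤ) - (p.1 : ℤ)) (a := 1) fun x hx => by
      obtain ⟨p, hp, rfl⟩ := Multiset.mem_map.mp hx
      have := (hM p hp).2.1
      omega
  rw [← hzero, Multiset.card_map, nsmul_one] at hcard
  simp only [w] at hcard
  exact_mod_cast hcard
end

section
/- Let G = L_n be the path graph on vertices 1,…,n. Then for all α ∈ ℤ^n: T_{[i]}(α) = α − ε_i + ε_{i+1} for all 1 ≤ i ≤ n−1, and T_{[i,j]}(α) = α − ε_i + ε_j for all 1 ≤ i < j ≤ n; that is, each T_{[i,j]} realizes the lowering operator. -/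
open Finset

/-- The path graph on `{1,…,n}`, with edges `{i, i+1}`. -/
def pathG (n : ℕ) : SimpleGraph (Fin n) :=
  SimpleGraph.fromRel (fun i j => (i : ℕ) + 1 = (j : ℕ))

instance pathG.adjDecidable (n : ℕ) : DecidableRel (pathG n).Adj := fun a b =>
  decidable_of_iff (a ≠ b ∧ ((a : ℕ) + 1 = (b : ℕ) ∨ (b : ℕ) + 1 = (a : ℕ)))
    (by simp [pathG, SimpleGraph.fromRel_adj])

/-- `T_{[m]} = T_1 ∘ T_2 ∘ … ∘ T_m` (1-based): since all topplings are
translations, it is the translation by `∑_{k < m} Δ_k`. -/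
def Tbracket {n : ℕ} (G : SimpleGraph (Fin n)) [DecidableRel G.Adj] (m : ℕ)
    (α : Fin n → ℤ) : Fin n → ℤ :=
  α + ∑ i ∈ Finset.univ.filter (fun i : Fin n => (i : ℕ) < m), topDelta G i

/-- `T_{[i,j]} = T_{[i]} ∘ T_{[i+1]} ∘ … ∘ T_{[j−1]}` (1-based). -/
def Tbij {n : ℕ} (G : SimpleGraph (Fin n)) [DecidableRel G.Adj] (i j : ℕ)
    (α : Fin n → ℤ) : Fin n → ℤ :=
  α + ∑ m ∈ Finset.Ico i j,
    ∑ k ∈ Finset.univ.filter (fun k : Fin n => (k : ℕ) < m), topDelta G k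

/-- The `k`-th standard basis vector of `ℤ^n`, 1-based: `(eps n k)_j = 1` iff
`j` is the `k`-th coordinate. -/
def eps (n : ℕ) (k : ℕ) : Fin n → ℤ := fun j => if (j : ℕ) + 1 = k then 1 else 0

theorem pathG_adj {n : ℕ} (a b : Fin n) :
    (pathG n).Adj a b ↔ (a : ℕ) + 1 = b ∨ (b : ℕ) + 1 = a := by
  simp only [pathG, SimpleGraph.fromRel_adj, ne_eq, Fin.ext_iff]
  omega

theorem pathG_degree_zero {n : ℕ} (h : 1 < n) :
    (pathG n).degree ⟨0, by omega⟩ = 1 := by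
  have : (pathG n).neighborFinset ⟨0, by omega⟩ = {⟨1, h⟩} := by
    ext b
    simp only [SimpleGraph.mem_neighborFinset, pathG_adj, mem_singleton, Fin.ext_iff]
    omega
  rw [← SimpleGraph.card_neighborFinset_eq_degree, this, card_singleton]

theorem pathG_degree_succ {n m : ℕ} (h : m + 2 < n) :
    (pathG n).degree ⟨m + 1, by omega⟩ = 2 := by
  have : (pathG n).neighborFinset ⟨m + 1, by omega⟩ = {⟨m, by omega⟩, ⟨m + 2, h⟩} := by
    ext b
    simp only [SimpleGraph.mem_neighborFinset, pathG_adj, mem_insert, mem_singleton, Fin.ext_iff]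
    omega
  rw [← SimpleGraph.card_neighborFinset_eq_degree, this, card_pair (by simp [Fin.ext_iff])]

theorem topDelta_pathG_zero {n : ℕ} (h : 1 < n) :
    topDelta (pathG n) ⟨0, by omega⟩ = eps n 2 - eps n 1 := by
  ext j
  simp only [topDelta, pathG_degree_zero h, pathG_adj, Fin.ext_iff, eps, Pi.sub_apply,
    Nat.add_eq_zero_iff, one_ne_zero, and_false, or_false]
  split_ifs <;> omega

theorem topDelta_pathG_succ {n m : ℕ} (h : m + 2 < n) :
    topDelta (pathG n) ⟨m + 1, by omega⟩ =
      (eps n (m + 3) - eps n (m + 2)) - (eps n (m + 2) - eps n (m + 1)) := by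
  ext j
  simp only [topDelta, pathG_degree_succ h, pathG_adj, Fin.ext_iff, eps, Pi.sub_apply]
  split_ifs <;> omega

theorem filter_val_lt_succ {n m : ℕ} (h : m < n) :
    univ.filter (fun k : Fin n => (k : ℕ) < m + 1) =
      insert ⟨m, h⟩ (univ.filter (fun k : Fin n => (k : ℕ) < m)) := by
  ext k
  simp only [mem_filter, mem_univ, true_and, mem_insert, Fin.ext_iff]
  omega

theorem sum_topDelta_pathG {n m : ℕ} (h : m + 1 < n) :
    ∑ k ∈ univ.filter (fun k : Fin n => (k : ℕ) < m + 1), topDelta (pathG n) k =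
      eps n (m + 2) - eps n (m + 1) := by
  rw [filter_val_lt_succ (by omega), sum_insert (by simp)]
  induction m with
  | zero => simpa using topDelta_pathG_zero h
  | succ m ih =>
    rw [filter_val_lt_succ (by omega), sum_insert (by simp), ih (by omega),
      topDelta_pathG_succ h]
    abel

/-- On the path graph, `T_{[i]}(α) = α − ε_i + ε_{i+1}` for `1 ≤ i ≤ n−1`, and
`T_{[i,j]}(α) = α − ε_i + ε_j` for `1 ≤ i < j ≤ n`: each `T_{[i,j]}` realizes
the lowering operator. -/
theorem path_lowering (n : ℕ) (hn : 2 ≤ n) :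
    (∀ i : ℕ, 1 ≤ i → i ≤ n - 1 → ∀ α : Fin n → ℤ,
        Tbracket (pathG n) i α = α - eps n i + eps n (i + 1)) ∧
      ∀ i j : ℕ, 1 ≤ i → i < j → j ≤ n → ∀ α : Fin n → ℤ,
        Tbij (pathG n) i j α = α - eps n i + eps n j := by
  constructor
  · intro i hi hin α
    obtain ⟨m, rfl⟩ := Nat.exists_eq_add_of_le' hi
    rw [Tbracket, sum_topDelta_pathG (by omega)]
    abel
  · intro i j hi hij hjn α
    have hsum : ∀ m ∈ Ico i j,
        ∑ k ∈ univ.filter (fun k : Fin n => (k : ℕ) < m), topDelta (pathG n) k =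
          eps n (m + 1) - eps n m := by
      intro m hm
      rw [mem_Ico] at hm
      obtain ⟨m, rfl⟩ := Nat.exists_eq_add_of_le' (hi.trans hm.1)
      exact sum_topDelta_pathG (by omega)
    rw [Tbij, sum_congr rfl hsum, sum_Ico_sub (eps n) hij.le]
    abel
end

section
/- Let α ∈ ℕ^n be a partition (α_1 ≥ α_2 ≥ … ≥ α_n ≥ 0). Then, in the polynomial ring ℤ[t][x_1,…,x_n], Σ_{w ∈ S_n} sgn(w) · σ_w( x^α · ∏_{1≤i<j≤n} (x_i − t·x_j) ) = ( Σ_{S ⊆ {(i,j) : 1 ≤ i < j ≤ n}} (−t)^{|S|} · s_{α + Σ_{(i,j)∈S} (ε_j − ε_i)} ) · ∏_{1≤i<j≤n} (x_i − x_j). (Dividing both sides by the Vandermonde product, the left-hand side is the Hall–Littlewood symmetric polynomial R_α(x;t) = Σ_{w∈S_n} w( x^α ∏_{i<j} (x_i − t x_j)/(x_i − x_j) ), so this expresses R_α(x;t) as the signed sum of the polynomials s_β over the square-free decompositions arising from the Yamanouchi toppling game on the path graph.) -/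
open Finset MvPolynomial

noncomputable section

/-- The complete homogeneous symmetric polynomial `h_k` in `x_1,…,x_n`, indexed
by an integer `k`, with the conventions `h_0 = 1` and `h_k = 0` for `k < 0`.
Coefficients are in `ℤ[t]`. -/
def hInt (n : ℕ) (k : ℤ) : MvPolynomial (Fin n) (Polynomial ℤ) :=
  if 0 ≤ k then MvPolynomial.hsymm (Fin n) (Polynomial ℤ) k.toNat else 0

/-- For `β ∈ ℤ^n`, the Jacobi–Trudi determinant
`s_β = det (h_{β_i + j − i})_{1 ≤ i,j ≤ n}`. -/
def sInt (n : ℕ) (β : Fin n → ℤ) : MvPolynomial (Fin n) (Polynomial ℤ) :=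
  Matrix.det (Matrix.of fun i j : Fin n => hInt n (β i + (j : ℕ) - (i : ℕ)))

/-- The generating function of the complete homogeneous symmetric polynomials is the product of
the geometric series `1 / (1 - x_i z)`. -/
theorem mk_hsymm_eq_prod (σ R : Type*) [Fintype σ] [DecidableEq σ] [CommRing R] :
    PowerSeries.mk (hsymm σ R) =
      ∏ i : σ, PowerSeries.mk fun m => (X i : MvPolynomial σ R) ^ m := by
  ext1 m
  rw [PowerSeries.coeff_mk, PowerSeries.coeff_prod, hsymm]
  simp only [PowerSeries.coeff_mk]
  have key (s : Sym σ m) : (s.1.map (X : σ → MvPolynomial σ R)).prod =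
      ∏ i, (X i : MvPolynomial σ R) ^ (Multiset.toFinsupp s.1) i := by
    rw [Finset.prod_multiset_map_count]
    simp only [Multiset.toFinsupp_apply]
    refine Finset.prod_subset (Finset.subset_univ _) fun i _ hi => ?_
    rw [Multiset.count_eq_zero_of_notMem (by simpa using hi), pow_zero]
  refine Finset.sum_bij (fun s _ => Multiset.toFinsupp s.1) ?_ ?_ ?_ fun s _ => key s
  · intro s _
    rw [mem_finsuppAntidiag]
    exact ⟨(Multiset.sum_count_eq_card fun a _ => Finset.mem_univ a).trans s.2,
      Finset.subset_univ _⟩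
  · intro s _ s' _ h
    exact Subtype.ext (Multiset.toFinsupp.injective h)
  · intro f hf
    refine ⟨⟨Finsupp.toMultiset f, ?_⟩, Finset.mem_univ _, Finsupp.toMultiset_toFinsupp f⟩
    rw [Finsupp.card_toMultiset, Finsupp.sum_fintype _ _ (by simp)]
    exact (mem_finsuppAntidiag.1 hf).1

/-- The geometric series `∑ r^m z^m` is inverse to `1 - r z`. -/
theorem mk_pow_mul_one_sub {R : Type*} [CommRing R] (r : R) :
    (PowerSeries.mk fun m => r ^ m) * (1 - PowerSeries.C r * PowerSeries.X) = 1 := by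
  have h := congrArg (PowerSeries.rescale r) (PowerSeries.mk_one_mul_one_sub_eq_one R)
  rw [map_mul, map_sub, map_one, PowerSeries.rescale_X] at h
  convert h
  ext m
  simp [PowerSeries.coeff_rescale]

/-- The polynomial `∏_{i ≠ k} (1 - x_i z)` in the auxiliary variable `z`. -/
def omitProd {σ : Type*} [Fintype σ] [DecidableEq σ] (R : Type*) [CommRing R] (k : σ) :
    Polynomial (MvPolynomial σ R) :=
  ∏ i ∈ Finset.univ.erase k, (1 - Polynomial.C (X i) * Polynomial.X)

theorem natDegree_omitProd_lt {σ : Type*} [Fintype σ] [DecidableEq σ] (R : Type*) [CommRing R]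
    (k : σ) : (omitProd R k).natDegree < Fintype.card σ := by
  have hle : (omitProd R k).natDegree ≤ ∑ _i ∈ Finset.univ.erase k, 1 := by
    refine (Polynomial.natDegree_prod_le _ _).trans (Finset.sum_le_sum fun i _ => ?_)
    compute_degree
  rw [Finset.sum_const, Finset.card_erase_of_mem (Finset.mem_univ k), Finset.card_univ,
    smul_eq_mul, mul_one] at hle
  have : 0 < Fintype.card σ := Fintype.card_pos_iff.2 ⟨k⟩
  omega

theorem mk_hsymm_mul_omitProd {σ : Type*} [Fintype σ] [DecidableEq σ] (R : Type*) [CommRing R]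
    (k : σ) : PowerSeries.mk (hsymm σ R) * (omitProd R k : PowerSeries (MvPolynomial σ R)) =
      PowerSeries.mk fun m => (X k : MvPolynomial σ R) ^ m := by
  have hcoe : (omitProd R k : PowerSeries (MvPolynomial σ R)) =
      ∏ i ∈ Finset.univ.erase k, (1 - PowerSeries.C (X i) * PowerSeries.X) := by
    rw [omitProd, ← Polynomial.coeToPowerSeries.ringHom_apply, map_prod]
    simp
  rw [mk_hsymm_eq_prod, hcoe, ← Finset.mul_prod_erase _ _ (Finset.mem_univ k), mul_assoc,
    ← Finset.prod_mul_distrib]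
  simp [mk_pow_mul_one_sub]

theorem sum_hInt_mul_coeff_omitProd (n : ℕ) (k : Fin n) (c : ℕ) :
    ∑ j : Fin n, hInt n (c - (j : ℕ)) * (omitProd (Polynomial ℤ) k).coeff j = X k ^ c := by
  have h := congrArg (PowerSeries.coeff c) (mk_hsymm_mul_omitProd (Polynomial ℤ) k)
  rw [mul_comm, PowerSeries.coeff_mul, PowerSeries.coeff_mk,
    Finset.Nat.sum_antidiagonal_eq_sum_range_succ_mk] at h
  simp only [PowerSeries.coeff_mk, Polynomial.coeff_coe] at h
  rw [← h, Fin.sum_univ_eq_sum_range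
    (fun m => hInt n (c - (m : ℕ)) * (omitProd (Polynomial ℤ) k).coeff m)]
  have hdeg := natDegree_omitProd_lt (Polynomial ℤ) k
  rw [Fintype.card_fin] at hdeg
  trans ∑ m ∈ Finset.range (n + (c + 1)),
      hInt n (c - (m : ℕ)) * (omitProd (Polynomial ℤ) k).coeff m
  · refine Finset.sum_subset (Finset.range_mono (by omega)) fun m _ hm => ?_
    rw [Finset.mem_range, not_lt] at hm
    rw [Polynomial.coeff_eq_zero_of_natDegree_lt (by omega), mul_zero]
  · symm
    refine (Finset.sum_congr rfl fun m hm => ?_).trans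
      (Finset.sum_subset (Finset.range_mono (by omega)) fun m _ hm => ?_)
    · rw [Finset.mem_range] at hm
      rw [mul_comm, hInt, if_pos (by omega), show ((c : ℤ) - m).toNat = c - m by omega]
    · rw [Finset.mem_range] at hm
      rw [hInt, if_neg (by omega), zero_mul]

theorem det_X_pow_eq_sInt_mul (n : ℕ) (c : Fin n → ℕ) :
    (Matrix.of fun i k : Fin n => (X k : MvPolynomial (Fin n) (Polynomial ℤ)) ^ c i).det =
      sInt n (fun i => (c i : ℤ) - (i.rev : ℕ)) *
        (Matrix.of fun j k : Fin n => (omitProd (Polynomial ℤ) k).coeff (j.rev : ℕ)).det := by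
  rw [sInt, ← Matrix.det_mul]
  congr 1
  ext1 i k
  rw [Matrix.mul_apply, Matrix.of_apply, ← sum_hInt_mul_coeff_omitProd,
    ← Equiv.sum_comp Fin.revPerm]
  refine Finset.sum_congr rfl fun j _ => ?_
  simp only [Matrix.of_apply, Fin.revPerm_apply]
  congr 2
  simp only [Fin.val_rev]
  omega

theorem sInt_zero (n : ℕ) : sInt n (fun _ => 0) = 1 := by
  rw [sInt, Matrix.det_of_isUpperTriangular]
  · exact Finset.prod_eq_one fun i _ => by simp [hInt]
  · intro i j hij
    have : (j : ℕ) < i := hij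
    rw [Matrix.of_apply, hInt, if_neg (by omega)]

theorem prod_lt_eq_prod_Ioi {ι M : Type*} [Fintype ι] [LinearOrder ι] [LocallyFiniteOrderTop ι]
    [CommMonoid M] (f : ι → ι → M) :
    ∏ p ∈ Finset.univ.filter (fun p : ι × ι => p.1 < p.2), f p.1 p.2 =
      ∏ i, ∏ j ∈ Finset.Ioi i, f i j := by
  rw [Finset.prod_filter, Fintype.prod_prod_type]
  refine Finset.prod_congr rfl fun i _ => ?_
  rw [← Finset.prod_filter]
  congr 1
  ext j
  simp

theorem det_X_pow_rev {n : ℕ} {R : Type*} [CommRing R] :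
    (Matrix.of fun i k : Fin n => (X k : MvPolynomial (Fin n) R) ^ (i.rev : ℕ)).det =
      ∏ p ∈ Finset.univ.filter (fun p : Fin n × Fin n => p.1 < p.2), (X p.1 - X p.2) := by
  rw [prod_lt_eq_prod_Ioi fun i j => (X i : MvPolynomial (Fin n) R) - X j, ← Matrix.det_transpose]
  have h := Matrix.det_projVandermonde (1 : Fin n → MvPolynomial (Fin n) R) X
  simp only [Pi.one_apply, one_mul] at h
  rw [← h]
  congr 1
  ext1 i j
  simp [Matrix.projVandermonde_apply]

/-- The bialternant formula: the alternant with exponents `β + δ`, where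
`δ = (n - 1, …, 1, 0)`, is the Jacobi–Trudi determinant `s_β` times the Vandermonde product. -/
theorem det_X_pow_eq_sInt_mul_prod (n : ℕ) (c : Fin n → ℕ) :
    (Matrix.of fun i k : Fin n => (X k : MvPolynomial (Fin n) (Polynomial ℤ)) ^ c i).det =
      sInt n (fun i => (c i : ℤ) - (i.rev : ℕ)) *
        ∏ p ∈ Finset.univ.filter (fun p : Fin n × Fin n => p.1 < p.2), (X p.1 - X p.2) := by
  have h := det_X_pow_eq_sInt_mul n fun i => (i.rev : ℕ)
  simp only [sub_self, sInt_zero, one_mul, det_X_pow_rev] at h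
  rw [det_X_pow_eq_sInt_mul, h]

theorem sum_sign_smul_rename_prod_X_pow {n : ℕ} {R : Type*} [CommRing R] (c : Fin n → ℕ) :
    ∑ w : Equiv.Perm (Fin n), (Equiv.Perm.sign w : ℤ) •
        rename ⇑w (∏ i, (X i : MvPolynomial (Fin n) R) ^ c i) =
      (Matrix.of fun i k : Fin n => (X k : MvPolynomial (Fin n) R) ^ c i).det := by
  rw [← Matrix.det_transpose, Matrix.det_apply]
  refine Finset.sum_congr rfl fun w _ => ?_
  simp [map_prod, Units.smul_def]

theorem prod_X_comp_eq_prod_pow {σ ι R : Type*} [Fintype σ] [DecidableEq σ] [CommSemiring R]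
    (T : Finset ι) (g : ι → σ) :
    ∏ p ∈ T, (X (g p) : MvPolynomial σ R) =
      ∏ i, X i ^ (T.filter fun p => g p = i).card := by
  rw [← Finset.prod_fiberwise T g]
  exact Finset.prod_congr rfl fun i _ => Finset.prod_eq_pow_card fun p hp => by
    rw [(Finset.mem_filter.1 hp).2]

theorem card_filter_lt_fst_eq {n : ℕ} (i : Fin n) :
    ((Finset.univ.filter fun p : Fin n × Fin n => p.1 < p.2).filter fun p => p.1 = i).card =
      (i.rev : ℕ) := by
  have hrev : (i.rev : ℕ) = (Finset.Ioi i).card := by rw [Fin.card_Ioi, Fin.val_rev]; omega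
  rw [hrev]
  refine Finset.card_bij' (fun p _ => p.2) (fun j _ => (i, j)) ?_ ?_ ?_ ?_ <;> aesop

/-- The Hall–Littlewood identity coming from the Yamanouchi toppling game on
the path graph: for a partition `α`,
`Σ_w sgn(w) σ_w(x^α ∏_{i<j} (x_i − t x_j))`
`= (Σ_{S ⊆ pairs} (−t)^{|S|} s_{α + Σ_{(i,j)∈S} (ε_j − ε_i)}) · ∏_{i<j} (x_i − x_j)`. -/
theorem hall_littlewood_toppling (n : ℕ) (α : Fin n → ℕ) (hα : Antitone α) :
    (∑ w : Equiv.Perm (Fin n), (Equiv.Perm.sign w : ℤ) •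
        (MvPolynomial.rename ⇑w)
          ((∏ i, (X i : MvPolynomial (Fin n) (Polynomial ℤ)) ^ α i) *
            ∏ p ∈ Finset.univ.filter (fun p : Fin n × Fin n => p.1 < p.2),
              (X p.1 - MvPolynomial.C Polynomial.X * X p.2))) =
      (∑ S ∈ (Finset.univ.filter (fun p : Fin n × Fin n => p.1 < p.2)).powerset,
          (-(MvPolynomial.C Polynomial.X : MvPolynomial (Fin n) (Polynomial ℤ)))
              ^ S.card *
            sInt n (fun i => (α i : ℤ) +
              ∑ p ∈ S, ((if i = p.2 then 1 else 0) - (if i = p.1 then 1 else 0)))) *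
        ∏ p ∈ Finset.univ.filter (fun p : Fin n × Fin n => p.1 < p.2),
          (X p.1 - X p.2) := by
  set P := Finset.univ.filter (fun p : Fin n × Fin n => p.1 < p.2)
  set t : MvPolynomial (Fin n) (Polynomial ℤ) := C Polynomial.X with ht
  let c (S : Finset (Fin n × Fin n)) (i : Fin n) : ℕ :=
    α i + (S.filter fun p => p.2 = i).card + ((P \ S).filter fun p => p.1 = i).card
  have hexpand : (∏ i, (X i : MvPolynomial (Fin n) (Polynomial ℤ)) ^ α i) *
      ∏ p ∈ P, (X p.1 - t * X p.2) =
      ∑ S ∈ P.powerset, (-t) ^ S.card * ∏ i, X i ^ c S i := by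
    have h := Finset.prod_add (fun p : Fin n × Fin n => -t * X p.2) (fun p => X p.1) P
    have hsub (p : Fin n × Fin n) : -t * X p.2 + X p.1 = X p.1 - t * X p.2 := by ring
    simp only [hsub] at h
    rw [h, Finset.mul_sum]
    refine Finset.sum_congr rfl fun S _ => ?_
    simp only [c, pow_add, Finset.prod_mul_distrib, Finset.prod_const,
      prod_X_comp_eq_prod_pow]
    ring
  have hc (S) (hS : S ∈ P.powerset) : (fun i => (c S i : ℤ) - (i.rev : ℕ)) =
      fun i => (α i : ℤ) + ∑ p ∈ S, ((if i = p.2 then 1 else 0) - (if i = p.1 then 1 else 0)) := by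
    funext i
    have hcard : ((P \ S).filter fun p => p.1 = i).card + (S.filter fun p => p.1 = i).card =
        (i.rev : ℕ) := by
      rw [← card_filter_lt_fst_eq i, Finset.card_filter, Finset.card_filter, Finset.card_filter]
      exact Finset.sum_sdiff (Finset.mem_powerset.1 hS)
    simp only [Finset.sum_sub_distrib, Finset.sum_boole, @eq_comm _ i, ← hcard, c]
    push_cast
    ring
  have hrename (w : Equiv.Perm (Fin n)) : rename (⇑w) (-t) = -t := by simp [ht]
  simp only [hexpand, map_sum, map_mul, map_pow, hrename, Finset.smul_sum]
  rw [Finset.sum_comm, Finset.sum_mul]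
  refine Finset.sum_congr rfl fun S hS => ?_
  rw [mul_assoc, ← hc S hS, ← det_X_pow_eq_sInt_mul_prod, ← sum_sign_smul_rename_prod_X_pow,
    Finset.mul_sum]
  exact Finset.sum_congr rfl fun w _ => by rw [mul_smul_comm]

end
end

section
/- For every coordinate index i and every S ⊆ Pairs_{n+1}, β(S)_i is a nonnegative integer, so P_n(t) is well defined; and for every integer m with 0 ≤ m ≤ n−1, L( t^m · P_n(t) ) = 0. (Hence the polynomials P_n are pairwise orthogonal with respect to L, being of degree at most n.) -/
open Finset Polynomial

noncomputable section

/-- The `k`-th moment `a_k = L(t^k)` of the linear functional `L`. -/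
def moment (L : Polynomial ℝ →ₗ[ℝ] ℝ) (k : ℕ) : ℝ := L (Polynomial.X ^ k)

/-- The set of pairs `(i,j)` with `1 ≤ i < j ≤ m`, encoded in `Fin m × Fin m`. -/
def pairsF (m : ℕ) : Finset (Fin m × Fin m) :=
  Finset.univ.filter (fun p => p.1 < p.2)

/-- `β(S) = (n,…,n,0) + Σ_{(i,j)∈S} (ε_j − ε_i) ∈ ℤ^{n+1}`. -/
def betaS (n : ℕ) (S : Finset (Fin (n + 1) × Fin (n + 1))) : Fin (n + 1) → ℤ :=
  fun i => (if (i : ℕ) = n then 0 else (n : ℤ)) +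
    ∑ p ∈ S, ((if i = p.2 then (1 : ℤ) else 0) - (if i = p.1 then (1 : ℤ) else 0))

/-- The `n`-th polynomial produced by the Yamanouchi toppling game on the path
graph: `P_n(t) = Σ_{S ⊆ Pairs_{n+1}} (−1)^{|S|} (∏_{i=1}^n a_{β(S)_i}) t^{β(S)_{n+1}}`. -/
def Ppoly (L : Polynomial ℝ →ₗ[ℝ] ℝ) (n : ℕ) : Polynomial ℝ :=
  ∑ S ∈ (pairsF (n + 1)).powerset,
    Polynomial.C ((-1 : ℝ) ^ S.card *
        ∏ i : Fin n, moment L (betaS n S i.castSucc).toNat) *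
      Polynomial.X ^ (betaS n S (Fin.last n)).toNat

/-- `γ(S) = (m−1,…,m−1) + Σ_{(i,j)∈S} (ε_j − ε_i) ∈ ℤ^m`. -/
def gammaS (m : ℕ) (S : Finset (Fin m × Fin m)) : Fin m → ℤ :=
  fun i => ((m : ℤ) - 1) +
    ∑ p ∈ S, ((if i = p.2 then (1 : ℤ) else 0) - (if i = p.1 then (1 : ℤ) else 0))

/-- `D_m = Σ_{S ⊆ Pairs_m} (−1)^{|S|} ∏_{i=1}^m a_{γ(S)_i}`. -/
def Dnum (L : Polynomial ℝ →ₗ[ℝ] ℝ) (m : ℕ) : ℝ :=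
  ∑ S ∈ (pairsF m).powerset,
    (-1 : ℝ) ^ S.card * ∏ i : Fin m, moment L (gammaS m S i).toNat

/-- The linear functional on multivariate polynomials which is a copy of `L` in each variable. -/
def tensorFunctional (L : Polynomial ℝ →ₗ[ℝ] ℝ) (σ : Type*) [Fintype σ] :
    MvPolynomial σ ℝ →ₗ[ℝ] ℝ :=
  (MvPolynomial.basisMonomials σ ℝ).constr ℝ fun s => ∏ i, moment L (s i)

theorem tensorFunctional_monomial (L : Polynomial ℝ →ₗ[ℝ] ℝ) {σ : Type*} [Fintype σ]
    (s : σ →₀ ℕ) :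
    tensorFunctional L σ (MvPolynomial.monomial s 1) = ∏ i, moment L (s i) := by
  simpa [tensorFunctional] using
    (MvPolynomial.basisMonomials σ ℝ).constr_basis ℝ (fun s => ∏ i, moment L (s i)) s

theorem tensorFunctional_rename (L : Polynomial ℝ →ₗ[ℝ] ℝ) {σ : Type*} [Fintype σ]
    (e : Equiv.Perm σ) (p : MvPolynomial σ ℝ) :
    tensorFunctional L σ (MvPolynomial.rename e p) = tensorFunctional L σ p := by
  suffices h : tensorFunctional L σ ∘ₗ (MvPolynomial.rename e).toLinearMap =
      tensorFunctional L σ from LinearMap.congr_fun h p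
  refine (MvPolynomial.basisMonomials σ ℝ).ext fun s => ?_
  simp only [MvPolynomial.coe_basisMonomials, LinearMap.comp_apply, AlgHom.toLinearMap_apply,
    MvPolynomial.rename_monomial, tensorFunctional_monomial]
  rw [← Equiv.prod_comp e]
  simp [Finsupp.mapDomain_apply e.injective]

theorem prod_pairsF_eq {R : Type*} [CommRing R] (m : ℕ) (v : Fin m → R) :
    ∏ p ∈ pairsF m, (v p.1 - v p.2) = (-1) ^ #(pairsF m) * (Matrix.vandermonde v).det := by
  have h : (Matrix.vandermonde v).det = ∏ p ∈ pairsF m, (v p.2 - v p.1) := by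
    rw [Matrix.det_vandermonde, pairsF, prod_filter, Fintype.prod_prod_type]
    refine prod_congr rfl fun i _ => ?_
    rw [← prod_filter]
    exact prod_congr (by ext; simp) fun _ _ => rfl
  rw [h, ← prod_const, ← prod_mul_distrib]
  exact prod_congr rfl fun _ _ => by ring

theorem prod_pairsF_swap {R : Type*} [CommRing R] {m : ℕ} (v : Fin m → R) {i j : Fin m}
    (hij : i ≠ j) :
    ∏ p ∈ pairsF m, (v (Equiv.swap i j p.1) - v (Equiv.swap i j p.2)) =
      -∏ p ∈ pairsF m, (v p.1 - v p.2) := by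
  have h := Matrix.det_permute (Equiv.swap i j) (Matrix.vandermonde v)
  rw [Equiv.Perm.sign_swap hij] at h
  have hv : (Matrix.vandermonde v).submatrix (Equiv.swap i j) id =
      Matrix.vandermonde (v ∘ Equiv.swap i j) := rfl
  rw [hv] at h
  have h' := prod_pairsF_eq m (v ∘ Equiv.swap i j)
  rw [h] at h'
  simp only [Function.comp_apply] at h'
  rw [h', prod_pairsF_eq]
  simp

theorem tensorFunctional_mul_vandermonde_eq_zero (L : Polynomial ℝ →ₗ[ℝ] ℝ) {m : ℕ}
    (s : Fin m →₀ ℕ) {i j : Fin m} (hij : i ≠ j) (hs : s i = s j) :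
    tensorFunctional L (Fin m) (MvPolynomial.monomial s 1 *
      ∏ p ∈ pairsF m, (MvPolynomial.X p.1 - MvPolynomial.X p.2)) = 0 := by
  have hsym : s.mapDomain (Equiv.swap i j) = s := by
    ext k
    obtain ⟨l, rfl⟩ := (Equiv.swap i j).surjective k
    rw [Finsupp.mapDomain_apply (Equiv.injective _)]
    rcases eq_or_ne l i with rfl | hi
    · simp [hs]
    rcases eq_or_ne l j with rfl | hj
    · simp [hs]
    rw [Equiv.swap_apply_of_ne_of_ne hi hj]
  have h := tensorFunctional_rename L (Equiv.swap i j) (MvPolynomial.monomial s 1 *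
    ∏ p ∈ pairsF m, (MvPolynomial.X p.1 - MvPolynomial.X p.2))
  simp only [map_mul, map_prod, map_sub, MvPolynomial.rename_X, MvPolynomial.rename_monomial,
    hsym] at h
  rw [prod_pairsF_swap _ hij, mul_neg, map_neg] at h
  linarith

/-- The exponent vector `(0, 1, …, n - 1, m)`. -/
def staircase (n m : ℕ) : Fin (n + 1) →₀ ℕ :=
  Finsupp.equivFunOnFinite.symm fun i => if (i : ℕ) = n then m else i

/-- The exponent vector of the term of `x^(staircase n m) * ∏_{i<j} (x_i - x_j)` in which `x_j`
is selected exactly from the factors indexed by `S`. -/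
def termExponent (n m : ℕ) (S : Finset (Fin (n + 1) × Fin (n + 1))) : Fin (n + 1) →₀ ℕ :=
  staircase n m + (∑ p ∈ pairsF (n + 1) \ S, Finsupp.single p.1 1 +
    ∑ p ∈ S, Finsupp.single p.2 1)

theorem sum_pairsF_fst (m : ℕ) (i : Fin m) :
    ∑ p ∈ pairsF m, (if i = p.1 then (1 : ℤ) else 0) = m - 1 - i := by
  have h : ∀ x : Fin m, (∑ y : Fin m, if x < y then if i = x then (1 : ℤ) else 0 else 0) =
      if i = x then ∑ y : Fin m, if i < y then 1 else 0 else 0 := by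
    intro x
    split_ifs with hx <;> simp [hx]
  rw [pairsF, sum_filter, Fintype.sum_prod_type]
  simp only [h]
  rw [sum_ite_eq univ i, if_pos (mem_univ i), sum_boole, filter_lt_eq_Ioi, Fin.card_Ioi]
  have := i.isLt
  omega

theorem termExponent_apply (n m : ℕ) {S : Finset (Fin (n + 1) × Fin (n + 1))}
    (hS : S ⊆ pairsF (n + 1)) (i : Fin (n + 1)) :
    (termExponent n m S i : ℤ) = betaS n S i + if (i : ℕ) = n then (m : ℤ) else 0 := by
  have h := sum_sdiff (f := fun p => if i = p.1 then (1 : ℤ) else 0) hS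
  rw [sum_pairsF_fst] at h
  simp only [termExponent, staircase, betaS, Finsupp.add_apply, Finsupp.finsetSum_apply,
    Finsupp.single_apply, Finsupp.equivFunOnFinite_symm_apply_apply, sum_sub_distrib]
  push_cast at h ⊢
  simp only [eq_comm (b := i)]
  split_ifs <;> omega

theorem betaS_nonneg (n : ℕ) {S : Finset (Fin (n + 1) × Fin (n + 1))}
    (hS : S ⊆ pairsF (n + 1)) (i : Fin (n + 1)) : 0 ≤ betaS n S i := by
  have h := termExponent_apply n 0 hS i
  simp only [Nat.cast_zero, ite_self, add_zero] at h
  omega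

theorem monomial_mul_prod_pairsF (n m : ℕ) :
    (MvPolynomial.monomial (staircase n m) 1 *
      ∏ p ∈ pairsF (n + 1), (MvPolynomial.X p.1 - MvPolynomial.X p.2) :
        MvPolynomial (Fin (n + 1)) ℝ) =
      ∑ S ∈ (pairsF (n + 1)).powerset,
        (-1 : ℝ) ^ #S • MvPolynomial.monomial (termExponent n m S) 1 := by
  have hX (i : Fin (n + 1)) : (MvPolynomial.X i : MvPolynomial (Fin (n + 1)) ℝ) =
    MvPolynomial.monomial (Finsupp.single i 1) 1 := rfl
  have hmul (a b : Fin (n + 1) →₀ ℕ) : (MvPolynomial.monomial (a + b) (1 : ℝ)) =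
      MvPolynomial.monomial a 1 * MvPolynomial.monomial b 1 := by
    rw [MvPolynomial.monomial_mul, one_mul]
  rw [prod_sub, mul_sum]
  refine sum_congr rfl fun S _ => ?_
  rw [termExponent, hmul, hmul, MvPolynomial.monomial_sum_one, MvPolynomial.monomial_sum_one,
    MvPolynomial.smul_eq_C_mul]
  simp only [hX, map_pow, map_neg, MvPolynomial.C_1]
  ring

theorem map_X_pow_mul_Ppoly (L : Polynomial ℝ →ₗ[ℝ] ℝ) (n m : ℕ) :
    L (Polynomial.X ^ m * Ppoly L n) =
      tensorFunctional L (Fin (n + 1)) (MvPolynomial.monomial (staircase n m) 1 *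
        ∏ p ∈ pairsF (n + 1), (MvPolynomial.X p.1 - MvPolynomial.X p.2)) := by
  rw [monomial_mul_prod_pairsF, Ppoly, mul_sum, map_sum, map_sum]
  refine sum_congr rfl fun S hS => ?_
  rw [mem_powerset] at hS
  rw [map_smul, tensorFunctional_monomial, mul_left_comm, ← pow_add, ← Polynomial.smul_eq_C_mul,
    map_smul, smul_eq_mul, smul_eq_mul, Fin.prod_univ_castSucc, mul_assoc]
  have hlast : m + (betaS n S (Fin.last n)).toNat = termExponent n m S (Fin.last n) := by
    have h := termExponent_apply n m hS (Fin.last n)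
    have := betaS_nonneg n hS (Fin.last n)
    simp only [Fin.val_last, if_true] at h
    omega
  have hcast (i : Fin n) :
      (betaS n S i.castSucc).toNat = termExponent n m S i.castSucc := by
    have h := termExponent_apply n m hS i.castSucc
    rw [if_neg (by simpa using i.isLt.ne)] at h
    omega
  simp only [hlast, hcast, moment]

/-- Every coordinate of `β(S)` is a nonnegative integer (so `P_n` is well
defined), and `L(t^m · P_n(t)) = 0` for all `0 ≤ m ≤ n − 1`. -/
theorem Ppoly_orthogonal (L : Polynomial ℝ →ₗ[ℝ] ℝ) (n : ℕ) (hn : 1 ≤ n) :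
    (∀ S ∈ (pairsF (n + 1)).powerset, ∀ i : Fin (n + 1), 0 ≤ betaS n S i) ∧
      ∀ m : ℕ, m ≤ n - 1 → L (Polynomial.X ^ m * Ppoly L n) = 0 := by
  refine ⟨fun S hS => betaS_nonneg n (mem_powerset.mp hS), fun m hm => ?_⟩
  have hlt : m < n := by omega
  rw [map_X_pow_mul_Ppoly]
  refine tensorFunctional_mul_vandermonde_eq_zero L _
    (i := ⟨m, by omega⟩) (j := Fin.last n) (Fin.ne_of_val_ne hlt.ne) ?_
  simp [staircase, hlt.ne]

end
end

section
/- P_n(t) has degree at most n, and the coefficient of t^n in P_n(t) equals (−1)^n · D_n. -/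
open Finset Polynomial

noncomputable section

/-- The embedding sending `i : Fin n` to the pair `(i, n)` in `Fin (n + 1)`. -/
def pairWithLast (n : ℕ) : Fin n ↪ Fin (n + 1) × Fin (n + 1) :=
  ⟨fun i => (i.castSucc, Fin.last n), fun _ _ h => by simpa using h⟩

lemma pairWithLast_apply {n : ℕ} (i : Fin n) :
    pairWithLast n i = (i.castSucc, Fin.last n) := rfl

/-- The pairs `(i, n)` with `i < n` in `Fin (n + 1)`. -/
def lastPairs (n : ℕ) : Finset (Fin (n + 1) × Fin (n + 1)) :=
  Finset.univ.map (pairWithLast n)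

/-- The embedding of pairs induced by `Fin.castSucc`. -/
def castSuccPair (n : ℕ) : Fin n × Fin n ↪ Fin (n + 1) × Fin (n + 1) :=
  ⟨fun p => (p.1.castSucc, p.2.castSucc), fun p q h => by
    simpa [Prod.ext_iff] using h⟩

lemma castSuccPair_apply {n : ℕ} (p : Fin n × Fin n) :
    castSuccPair n p = (p.1.castSucc, p.2.castSucc) := rfl

/-- Extend a set of pairs on `Fin n` by all the pairs ending in the last vertex. -/
def extendLast (n : ℕ) (S : Finset (Fin n × Fin n)) : Finset (Fin (n + 1) × Fin (n + 1)) :=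
  S.map (castSuccPair n) ∪ lastPairs n

lemma mem_lastPairs {n : ℕ} {p : Fin (n + 1) × Fin (n + 1)} :
    p ∈ lastPairs n ↔ p.1 < p.2 ∧ p.2 = Fin.last n := by
  obtain ⟨a, b⟩ := p
  simp only [lastPairs, Finset.mem_map, Finset.mem_univ, true_and,
    pairWithLast_apply, Prod.mk.injEq]
  constructor
  · rintro ⟨i, rfl, rfl⟩
    exact ⟨Fin.castSucc_lt_last i, rfl⟩
  · rintro ⟨hab, rfl⟩
    exact ⟨a.castPred hab.ne, Fin.castSucc_castPred _ _, rfl⟩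

lemma card_lastPairs (n : ℕ) : (lastPairs n).card = n := by
  simp [lastPairs]

lemma disjoint_map_castSuccPair_lastPairs {n : ℕ} (S : Finset (Fin n × Fin n)) :
    Disjoint (S.map (castSuccPair n)) (lastPairs n) := by
  rw [Finset.disjoint_left]
  intro p hp hl
  obtain ⟨q, -, rfl⟩ := Finset.mem_map.1 hp
  exact (Fin.castSucc_lt_last q.2).ne (mem_lastPairs.1 hl).2

lemma card_extendLast {n : ℕ} (S : Finset (Fin n × Fin n)) :
    (extendLast n S).card = S.card + n := by
  rw [extendLast, Finset.card_union_of_disjoint (disjoint_map_castSuccPair_lastPairs S),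
    Finset.card_map, card_lastPairs]

lemma extendLast_injective (n : ℕ) : Function.Injective (extendLast n) := by
  intro S T h
  have h' := congrArg (fun U => U \ lastPairs n) h
  simp only [extendLast, Finset.union_sdiff_right] at h'
  rw [Finset.sdiff_eq_self_of_disjoint (disjoint_map_castSuccPair_lastPairs S),
    Finset.sdiff_eq_self_of_disjoint (disjoint_map_castSuccPair_lastPairs T)] at h'
  exact Finset.map_injective _ h'

lemma extendLast_subset {n : ℕ} {S : Finset (Fin n × Fin n)} (hS : S ⊆ pairsF n) :
    extendLast n S ⊆ pairsF (n + 1) := by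
  intro p hp
  rw [pairsF, Finset.mem_filter]
  refine ⟨Finset.mem_univ _, ?_⟩
  rcases Finset.mem_union.1 hp with hp | hp
  · obtain ⟨q, hq, rfl⟩ := Finset.mem_map.1 hp
    exact Fin.castSucc_lt_castSucc_iff.2 (Finset.mem_filter.1 (hS hq)).2
  · exact (mem_lastPairs.1 hp).1

lemma exists_extendLast_eq {n : ℕ} {S : Finset (Fin (n + 1) × Fin (n + 1))}
    (hS : S ⊆ pairsF (n + 1)) (hl : lastPairs n ⊆ S) :
    ∃ T ⊆ pairsF n, extendLast n T = S := by
  refine ⟨(pairsF n).filter (fun q => castSuccPair n q ∈ S), Finset.filter_subset _ _, ?_⟩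
  ext p
  rw [extendLast, Finset.mem_union, Finset.mem_map]
  constructor
  · rintro (⟨q, hq, rfl⟩ | hp)
    · exact (Finset.mem_filter.1 hq).2
    · exact hl hp
  · intro hp
    have hlt : p.1 < p.2 := (Finset.mem_filter.1 (hS hp)).2
    by_cases h2 : p.2 = Fin.last n
    · exact Or.inr (mem_lastPairs.2 ⟨hlt, h2⟩)
    · left
      have h1 : p.1 ≠ Fin.last n := (hlt.trans_le (Fin.le_last _)).ne
      have hq : castSuccPair n (p.1.castPred h1, p.2.castPred h2) = p := by
        simp [castSuccPair_apply]
      refine ⟨_, Finset.mem_filter.2 ⟨?_, hq.symm ▸ hp⟩, hq⟩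
      simpa [pairsF] using hlt

lemma betaS_last {n : ℕ} {S : Finset (Fin (n + 1) × Fin (n + 1))}
    (hS : S ⊆ pairsF (n + 1)) :
    betaS n S (Fin.last n) = (S ∩ lastPairs n).card := by
  rw [← Finset.filter_mem_eq_inter, Finset.card_filter]
  simp only [betaS, Fin.val_last, if_true, zero_add]
  push_cast
  refine Finset.sum_congr rfl fun p hp => ?_
  have hlt : p.1 < p.2 := (Finset.mem_filter.1 (hS hp)).2
  have h1 : Fin.last n ≠ p.1 := (hlt.trans_le (Fin.le_last _)).ne'
  simp [mem_lastPairs, hlt, h1, eq_comm]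

lemma betaS_extendLast_castSucc {n : ℕ} (S : Finset (Fin n × Fin n)) (i : Fin n) :
    betaS n (extendLast n S) i.castSucc = gammaS n S i := by
  have hi : (i : ℕ) ≠ n := i.isLt.ne
  have hl : i.castSucc ≠ Fin.last n := (Fin.castSucc_lt_last i).ne
  rw [betaS, extendLast, Finset.sum_union (disjoint_map_castSuccPair_lastPairs S),
    Finset.sum_map, lastPairs, Finset.sum_map]
  simp [gammaS, castSuccPair_apply, pairWithLast_apply, hi, hl]
  ring

lemma toNat_betaS_last_le {n : ℕ} {S : Finset (Fin (n + 1) × Fin (n + 1))}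
    (hS : S ⊆ pairsF (n + 1)) : (betaS n S (Fin.last n)).toNat ≤ n := by
  rw [betaS_last hS, Int.toNat_natCast]
  exact (Finset.card_le_card Finset.inter_subset_right).trans_eq (card_lastPairs n)

lemma toNat_betaS_last_eq_iff {n : ℕ} {S : Finset (Fin (n + 1) × Fin (n + 1))}
    (hS : S ⊆ pairsF (n + 1)) :
    (betaS n S (Fin.last n)).toNat = n ↔ lastPairs n ⊆ S := by
  rw [betaS_last hS, Int.toNat_natCast, ← Finset.inter_eq_right]
  constructor
  · intro h
    exact Finset.eq_of_subset_of_card_le Finset.inter_subset_right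
      (by rw [h, card_lastPairs])
  · intro h
    rw [h, card_lastPairs]

/-- `P_n(t)` has degree at most `n`, and its coefficient of `t^n` is
`(−1)^n · D_n`. -/
theorem Ppoly_degree_leadingCoeff (L : Polynomial ℝ →ₗ[ℝ] ℝ) (n : ℕ) (hn : 1 ≤ n) :
    (Ppoly L n).degree ≤ (n : ℕ) ∧ (Ppoly L n).coeff n = (-1 : ℝ) ^ n * Dnum L n := by
  refine ⟨?_, ?_⟩
  · refine (Polynomial.degree_sum_le _ _).trans (Finset.sup_le fun S hS => ?_)
    exact (Polynomial.degree_C_mul_X_pow_le _ _).trans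
      (Nat.cast_le.2 (toNat_betaS_last_le (Finset.mem_powerset.1 hS)))
  · rw [Ppoly, Polynomial.finsetSum_coeff, Dnum, Finset.mul_sum]
    symm
    refine Finset.sum_of_injOn (extendLast n) (extendLast_injective n).injOn
      (fun S hS => ?_) (fun S hS hS' => ?_) (fun S hS => ?_)
    · exact Finset.mem_coe.2 (Finset.mem_powerset.2
        (extendLast_subset (Finset.mem_powerset.1 (Finset.mem_coe.1 hS))))
    · rw [Finset.mem_powerset] at hS
      rw [Polynomial.coeff_C_mul_X_pow, if_neg]
      intro h
      obtain ⟨T, hT, rfl⟩ := exists_extendLast_eq hS ((toNat_betaS_last_eq_iff hS).1 h.symm)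
      exact hS' ⟨T, Finset.mem_coe.2 (Finset.mem_powerset.2 hT), rfl⟩
    · rw [Finset.mem_powerset] at hS
      have h := (toNat_betaS_last_eq_iff (extendLast_subset hS)).2
        Finset.subset_union_right
      rw [Polynomial.coeff_C_mul_X_pow, if_pos h.symm, card_extendLast]
      simp only [betaS_extendLast_castSucc]
      ring

end
end

section
/- L( P_n(t)² ) = (−1)^n · D_n · D_{n+1}. In particular, if D_n ≠ 0 and D_{n+1} ≠ 0 then L( P_n(t)² ) ≠ 0. -/
open Finset Polynomial

noncomputable section

/-- The linear functional on polynomials in `m` variables applying `f i` to the exponent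
of the `i`-th variable. -/
def umbral {A : Type*} [CommRing A] {m : ℕ} (f : Fin m → ℕ → A) :
    MvPolynomial (Fin m) ℤ →ₗ[ℤ] A :=
  (MvPolynomial.basisMonomials (Fin m) ℤ).constr ℤ (fun s => ∏ i, f i (s i))

lemma umbral_prod_X_pow {A : Type*} [CommRing A] {m : ℕ} (f : Fin m → ℕ → A)
    (e : Fin m → ℕ) :
    umbral f (∏ i, MvPolynomial.X i ^ e i) = ∏ i, f i (e i) := by
  have h : (∏ i, MvPolynomial.X i ^ e i : MvPolynomial (Fin m) ℤ) =
      MvPolynomial.basisMonomials (Fin m) ℤ (Finsupp.equivFunOnFinite.symm e) := by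
    rw [MvPolynomial.coe_basisMonomials]
    beta_reduce
    rw [MvPolynomial.monomial_eq,
      Finsupp.prod_fintype _ _ (fun i => pow_zero _)]
    simp
  rw [h, umbral, Module.Basis.constr_basis]
  simp

lemma prod_comp_eq_prod_pow_card {ι κ R : Type*} [Fintype κ] [DecidableEq κ] [CommMonoid R]
    (s : Finset ι) (g : ι → κ) (x : κ → R) :
    ∏ p ∈ s, x (g p) = ∏ i, x i ^ #{p ∈ s | g p = i} := by
  rw [← Finset.prod_fiberwise s g]
  refine Finset.prod_congr rfl fun i _ => ?_
  rw [← Finset.prod_const]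
  refine Finset.prod_congr rfl fun p hp => ?_
  rw [(Finset.mem_filter.mp hp).2]

lemma prod_pairsF {R : Type*} [CommMonoid R] (m : ℕ) (g : Fin m → Fin m → R) :
    ∏ p ∈ pairsF m, g p.1 p.2 = ∏ i, ∏ j ∈ Ioi i, g i j := by
  rw [pairsF, Finset.prod_filter, Fintype.prod_prod_type]
  refine Finset.prod_congr rfl fun i _ => ?_
  rw [← Finset.prod_filter]
  refine Finset.prod_congr ?_ fun _ _ => rfl
  ext j
  simp

lemma sum_pairsF {R : Type*} [AddCommMonoid R] (m : ℕ) (g : Fin m → Fin m → R) :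
    ∑ p ∈ pairsF m, g p.1 p.2 = ∑ i, ∑ j ∈ Ioi i, g i j :=
  prod_pairsF (R := Multiplicative R) m g

lemma card_pairsF_succ (n : ℕ) : #(pairsF (n + 1)) = #(pairsF n) + n := by
  have h (m : ℕ) : #(pairsF m) = ∑ i ∈ Finset.range m, i := by
    have := sum_pairsF m (fun _ _ => 1)
    rw [Finset.card_eq_sum_ones, this, Finset.sum_range, ← Equiv.sum_comp Fin.revPerm]
    refine Finset.sum_congr rfl fun i _ => ?_
    simp [Fin.card_Ioi]
    omega
  rw [h, h, Finset.sum_range_succ]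

lemma card_pairsF_filter_fst {m : ℕ} (i : Fin m) :
    #{p ∈ pairsF m | p.1 = i} = m - 1 - i := by
  have := sum_pairsF m (fun a _ => if a = i then 1 else 0)
  rw [Finset.card_filter, this]
  simp

/-- The exponent of the `i`-th variable in the term of `∏_{a < b} (x_a - x_b)` that takes
`x_b` for `(a, b) ∈ S` and `x_a` otherwise. -/
def tournamentScore (m : ℕ) (S : Finset (Fin m × Fin m)) (i : Fin m) : ℕ :=
  #{p ∈ S | p.2 = i} + #{p ∈ pairsF m \ S | p.1 = i}

theorem sum_powerset_pairsF_eq_det {A : Type*} [CommRing A] (m : ℕ) (f : Fin m → ℕ → A) :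
    ∑ S ∈ (pairsF m).powerset, (-1 : A) ^ #S * ∏ i, f i (tournamentScore m S i) =
      (-1) ^ #(pairsF m) * (Matrix.of fun i j : Fin m => f i j).det := by
  let x : Fin m → MvPolynomial (Fin m) ℤ := MvPolynomial.X
  have key : ∑ S ∈ (pairsF m).powerset, (-1 : ℤ) ^ #S • ∏ i, x i ^ tournamentScore m S i =
      (-1 : ℤ) ^ #(pairsF m) • ∑ σ : Equiv.Perm (Fin m),
        (Equiv.Perm.sign σ : ℤ) • ∏ i, x i ^ (σ i : ℕ) := by
    have hdet : ∑ σ : Equiv.Perm (Fin m), (Equiv.Perm.sign σ : ℤ) • ∏ i, x i ^ (σ i : ℕ) =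
        (Matrix.vandermonde x).det := by
      rw [← Matrix.det_transpose, Matrix.det_apply]
      rfl
    rw [hdet, Matrix.det_vandermonde, ← prod_pairsF m (fun i j => x j - x i)]
    have hneg : (-1 : ℤ) ^ #(pairsF m) • ∏ p ∈ pairsF m, (x p.2 - x p.1) =
        ∏ p ∈ pairsF m, (-x p.2 + x p.1) := by
      rw [zsmul_eq_mul]
      push_cast
      rw [← Finset.prod_const, ← Finset.prod_mul_distrib]
      exact Finset.prod_congr rfl fun p _ => by ring
    rw [hneg, Finset.prod_add]
    refine Finset.sum_congr rfl fun S _ => ?_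
    rw [Finset.prod_neg, prod_comp_eq_prod_pow_card S Prod.snd x,
      prod_comp_eq_prod_pow_card (pairsF m \ S) Prod.fst x, mul_assoc,
      ← Finset.prod_mul_distrib, zsmul_eq_mul]
    push_cast
    simp only [tournamentScore, pow_add]
  have h := congrArg (umbral f) key
  simp only [map_sum, map_smul, x, umbral_prod_X_pow] at h
  simp only [zsmul_eq_mul] at h
  push_cast at h
  rw [h, ← Matrix.det_transpose, Matrix.det_apply']
  rfl

lemma sum_single_sub_single {m : ℕ} {S : Finset (Fin m × Fin m)} (hS : S ⊆ pairsF m)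
    (i : Fin m) :
    ∑ p ∈ S, ((if i = p.2 then (1 : ℤ) else 0) - (if i = p.1 then (1 : ℤ) else 0)) =
      tournamentScore m S i + i + 1 - m := by
  have h1 : #{p ∈ pairsF m \ S | p.1 = i} + #{p ∈ S | p.1 = i} = m - 1 - i := by
    rw [← card_pairsF_filter_fst i]
    simp only [Finset.card_filter]
    exact Finset.sum_sdiff hS
  have h2 : ∑ p ∈ S, ((if i = p.2 then (1 : ℤ) else 0) - (if i = p.1 then (1 : ℤ) else 0)) =
      #{p ∈ S | p.2 = i} - #{p ∈ S | p.1 = i} := by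
    simp only [Finset.sum_sub_distrib, Finset.sum_boole, eq_comm]
  rw [h2, tournamentScore]
  have := i.isLt
  omega

/-- The `m × m` Hankel matrix of moments. -/
def hankel (L : ℝ[X] →ₗ[ℝ] ℝ) (m : ℕ) : Matrix (Fin m) (Fin m) ℝ :=
  Matrix.of fun i j => moment L (i + j)

theorem Dnum_eq_det_hankel (L : ℝ[X] →ₗ[ℝ] ℝ) (m : ℕ) :
    Dnum L m = (-1) ^ #(pairsF m) * (hankel L m).det := by
  rw [hankel, ← sum_powerset_pairsF_eq_det m (fun i k => moment L (i + k)), Dnum]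
  refine Finset.sum_congr rfl fun S hS => ?_
  congr 1
  refine Finset.prod_congr rfl fun i _ => ?_
  rw [gammaS, sum_single_sub_single (Finset.mem_powerset.mp hS)]
  congr 1
  omega

/-- The cofactor of the `j`-th entry of the last row of the Hankel matrix of size `n + 1`. -/
def hankelCofactor (L : ℝ[X] →ₗ[ℝ] ℝ) (n : ℕ) (j : Fin (n + 1)) : ℝ :=
  (-1) ^ (n + j : ℕ) *
    (Matrix.of fun i k : Fin n => moment L (i + (j.succAbove k : Fin (n + 1)))).det

lemma hankelCofactor_last (L : ℝ[X] →ₗ[ℝ] ℝ) (n : ℕ) :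
    hankelCofactor L n (Fin.last n) = (hankel L n).det := by
  simp [hankelCofactor, hankel, ← two_mul, pow_mul]

lemma sum_hankelCofactor_mul_moment (L : ℝ[X] →ₗ[ℝ] ℝ) (n : ℕ) (k : Fin (n + 1)) :
    ∑ j : Fin (n + 1), hankelCofactor L n j * moment L (k + j) =
      if k = Fin.last n then (hankel L (n + 1)).det else 0 := by
  have h : ∑ j : Fin (n + 1), hankelCofactor L n j * moment L (k + j) =
      ((hankel L (n + 1)).updateRow (Fin.last n) (hankel L (n + 1) k)).det := by
    rw [Matrix.det_succ_row _ (Fin.last n)]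
    refine Finset.sum_congr rfl fun j _ => ?_
    rw [Matrix.submatrix_updateRow_succAbove, Matrix.updateRow_self, hankelCofactor,
      Fin.val_last, mul_right_comm]
    congr 2
    ext a b
    simp [hankel]
  rw [h]
  split_ifs with hk
  · rw [hk, Matrix.updateRow_eq_self]
  · exact Matrix.det_updateRow_eq_zero (hk)

theorem Ppoly_eq_sum_hankelCofactor (L : ℝ[X] →ₗ[ℝ] ℝ) (n : ℕ) :
    Ppoly L n =
      (-1) ^ #(pairsF (n + 1)) * ∑ j : Fin (n + 1), C (hankelCofactor L n j) * X ^ (j : ℕ) := by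
  let f : Fin (n + 1) → ℕ → ℝ[X] :=
    Fin.snoc (α := fun _ => ℕ → ℝ[X]) (fun i k => C (moment L (i + k))) (fun k => X ^ k)
  have hf : Ppoly L n = ∑ S ∈ (pairsF (n + 1)).powerset,
      (-1) ^ #S * ∏ i, f i (tournamentScore (n + 1) S i) := by
    refine Finset.sum_congr rfl fun S hS => ?_
    have hS := Finset.mem_powerset.mp hS
    rw [Fin.prod_univ_castSucc]
    simp only [f, Fin.snoc_castSucc, Fin.snoc_last, map_mul, map_pow, map_neg, map_one, map_prod,
      mul_assoc]
    congr 2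
    · refine Finset.prod_congr rfl fun i _ => ?_
      have := i.isLt
      rw [betaS, sum_single_sub_single hS, if_neg (by simpa using this.ne)]
      congr 2
      simp only [Fin.val_castSucc]
      omega
    · rw [betaS, sum_single_sub_single hS, if_pos (by simp)]
      congr 1
      simp only [Fin.val_last]
      omega
  rw [hf, sum_powerset_pairsF_eq_det, Matrix.det_succ_row _ (Fin.last n)]
  congr 1
  refine Finset.sum_congr rfl fun j _ => ?_
  rw [hankelCofactor, map_mul, RingHom.map_det, mul_right_comm]
  congr 2
  · simp
  · congr 1
    ext1 a b
    simp [f]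
  · simp [f]

/-- `L(P_n(t)²) = (−1)^n · D_n · D_{n+1}`; in particular it is nonzero whenever
`D_n ≠ 0` and `D_{n+1} ≠ 0`. -/
theorem Ppoly_norm (L : Polynomial ℝ →ₗ[ℝ] ℝ) (n : ℕ) (hn : 1 ≤ n) :
    L (Ppoly L n ^ 2) = (-1 : ℝ) ^ n * Dnum L n * Dnum L (n + 1) ∧
      (Dnum L n ≠ 0 → Dnum L (n + 1) ≠ 0 → L (Ppoly L n ^ 2) ≠ 0) := by
  have hsq : Ppoly L n ^ 2 = ∑ k : Fin (n + 1), ∑ j : Fin (n + 1),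
      (hankelCofactor L n k * hankelCofactor L n j) • X ^ (k + j : ℕ) := by
    rw [Ppoly_eq_sum_hankelCofactor, mul_pow, ← pow_mul, mul_comm _ 2, pow_mul, neg_one_sq,
      one_pow, one_mul, sq, Finset.sum_mul_sum]
    refine Finset.sum_congr rfl fun k _ => Finset.sum_congr rfl fun j _ => ?_
    rw [smul_eq_C_mul, map_mul, pow_add]
    ring
  have hL : L (Ppoly L n ^ 2) = (hankel L n).det * (hankel L (n + 1)).det := by
    rw [hsq]
    simp only [map_sum, map_smul, smul_eq_mul, mul_assoc, ← Finset.mul_sum]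
    change ∑ k : Fin (n + 1), hankelCofactor L n k *
      ∑ j : Fin (n + 1), hankelCofactor L n j * moment L (k + j) = _
    simp [sum_hankelCofactor_mul_moment, hankelCofactor_last]
  have hD : L (Ppoly L n ^ 2) = (-1 : ℝ) ^ n * Dnum L n * Dnum L (n + 1) := by
    rw [hL, Dnum_eq_det_hankel, Dnum_eq_det_hankel, card_pairsF_succ, pow_add]
    have h (k : ℕ) : (-1 : ℝ) ^ k * (-1) ^ k = 1 := by rw [← mul_pow]; simp
    have hc := h (pairsF n).card
    have hs := h n
    linear_combination (-(hankel L n).det * (hankel L (n + 1)).det) *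
      ((-1) ^ n * (-1) ^ n * hc + hs)
  refine ⟨hD, fun h₁ h₂ => ?_⟩
  rw [hD]
  exact mul_ne_zero (mul_ne_zero (pow_ne_zero _ (by norm_num)) h₁) h₂

end
end
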